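/- Let A_1 = (1, 2, 3, 4, 5, …) be the sequence of consecutive positive integers (a_i = i). Then for every integer n > 61, p_{A_1}(n,5)² > (1 + 1/n²)·p_{A_1}(n+1,5)·p_{A_1}(n−1,5). Moreover, p_{A_1}(n,5)² > p_{A_1}(n+1,5)·p_{A_1}(n−1,5) for all integers n > 37. -/

import Mathlib

/-- The restricted partition function `p_A(n,k)` for the sequence `a` (0-indexed, so the
paper's `a_i` is `a (i-1)`): the number of `k`-tuples `(c_0,…,c_{k-1})` of nonnegative
integers with `c_0·a_0 + ⋯ + c_{k-1}·a_{k-1} = n`.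
It equals `0` for `n < 0` and `1` for `n = 0`. -/
noncomputable def pA (a : ℕ → ℕ) (k : ℕ) (n : ℤ) : ℕ :=
  Set.ncard {c : Fin k → ℕ | (∑ i, (c i : ℤ) * (a i.val : ℤ)) = n}

/-- The solutions in nonnegative integers counted by `pA a k n` form a finite set. -/
lemma pA_finite {a : ℕ → ℕ} (ha : ∀ i, 0 < a i) (k : ℕ) (n : ℤ) :
    {c : Fin k → ℕ | (∑ i, (c i : ℤ) * (a i.val : ℤ)) = n}.Finite := by
  refine (Set.finite_Iic (fun _ : Fin k => n.toNat)).subset fun c hc i => ?_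
  have hle : (c i : ℤ) * (a i.val : ℤ) ≤ n := by
    rw [← (hc : _ = n)]
    exact Finset.single_le_sum (f := fun i : Fin k => (c i : ℤ) * (a i.val : ℤ))
      (fun j _ => by positivity) (Finset.mem_univ i)
  have hai : (1 : ℤ) ≤ a i.val := by exact_mod_cast ha i
  have : (c i : ℤ) ≤ n := by nlinarith
  show c i ≤ n.toNat
  omega

lemma pA_of_neg (a : ℕ → ℕ) (k : ℕ) {n : ℤ} (hn : n < 0) : pA a k n = 0 := by
  have : {c : Fin k → ℕ | (∑ i, (c i : ℤ) * (a i.val : ℤ)) = n} = ∅ := by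
    refine Set.eq_empty_of_forall_notMem fun c hc => ?_
    have h : 0 ≤ ∑ i, (c i : ℤ) * (a i.val : ℤ) := Finset.sum_nonneg fun i _ => by positivity
    rw [(hc : _ = n)] at h
    omega
  rw [pA, this, Set.ncard_empty]

lemma pA_zero_right (a : ℕ → ℕ) (n : ℤ) : pA a 0 n = if n = 0 then 1 else 0 := by
  by_cases hn : n = 0
  · simp [pA, hn]
  · simp [pA, hn, Ne.symm hn]

/-- Split the solutions according to whether the last part occurs. -/
lemma pA_succ {a : ℕ → ℕ} (ha : ∀ i, 0 < a i) (k : ℕ) (n : ℤ) :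
    pA a (k + 1) n = pA a k n + pA a (k + 1) (n - a k) := by
  let f : (Fin k → ℕ) → Fin (k + 1) → ℕ := fun c => Fin.snoc c 0
  let g : (Fin (k + 1) → ℕ) → Fin (k + 1) → ℕ := fun c => c + Pi.single (Fin.last k) 1
  have hf : f.Injective := fun c d h => by
    funext i
    simpa [f] using congrFun h i.castSucc
  have hg : g.Injective := fun c d h => add_right_cancel h
  have hset : {c : Fin (k + 1) → ℕ | (∑ i, (c i : ℤ) * (a i.val : ℤ)) = n} =
      f '' {c : Fin k → ℕ | (∑ i, (c i : ℤ) * (a i.val : ℤ)) = n} ∪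
      g '' {c : Fin (k + 1) → ℕ | (∑ i, (c i : ℤ) * (a i.val : ℤ)) = n - a k} := by
    ext c
    simp only [Set.mem_union, Set.mem_image, Set.mem_ofPred_eq]
    constructor
    · intro hc
      rcases Nat.eq_zero_or_pos (c (Fin.last k)) with h | h
      · refine Or.inl ⟨fun i => c i.castSucc, ?_, ?_⟩
        · simpa [Fin.sum_univ_castSucc, h] using hc
        · funext i
          refine Fin.lastCases ?_ (fun j => ?_) i <;> simp [f, h]
      · refine Or.inr ⟨c - Pi.single (Fin.last k) 1, ?_, ?_⟩
        · rw [Fin.sum_univ_castSucc] at hc ⊢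
          simp [Nat.cast_sub h] at hc ⊢
          linarith
        · funext i
          refine Fin.lastCases ?_ (fun j => ?_) i
          · simp [g]; omega
          · simp [g]
    · rintro (⟨d, hd, rfl⟩ | ⟨d, hd, rfl⟩)
      · simpa [Fin.sum_univ_castSucc, f] using hd
      · rw [Fin.sum_univ_castSucc] at hd ⊢
        simp [g] at hd ⊢
        linarith
  have hdisj : Disjoint (f '' {c : Fin k → ℕ | (∑ i, (c i : ℤ) * (a i.val : ℤ)) = n})
      (g '' {c : Fin (k + 1) → ℕ | (∑ i, (c i : ℤ) * (a i.val : ℤ)) = n - a k}) := by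
    rw [Set.disjoint_left]
    rintro _ ⟨c, -, rfl⟩ ⟨d, -, h⟩
    simpa [f, g] using congrFun h (Fin.last k)
  rw [pA, hset, Set.ncard_union_eq hdisj ((pA_finite ha k n).image f)
    ((pA_finite ha (k + 1) _).image g), Set.ncard_image_of_injective _ hf,
    Set.ncard_image_of_injective _ hg, pA, pA]

/-- Computable count of the partitions of `n` into parts of size at most `k`. -/
def partsAtMost : ℕ → ℕ → ℕ
  | 0, n => if n = 0 then 1 else 0
  | k + 1, n => ((List.range (n / (k + 1) + 1)).map fun j => partsAtMost k (n - j * (k + 1))).sum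

lemma partsAtMost_of_lt {k n : ℕ} (h : n < k + 1) :
    partsAtMost (k + 1) n = partsAtMost k n := by
  simp [partsAtMost, Nat.div_eq_of_lt h]

lemma partsAtMost_add (k n : ℕ) :
    partsAtMost (k + 1) (n + (k + 1)) = partsAtMost k (n + (k + 1)) + partsAtMost (k + 1) n := by
  rw [partsAtMost, partsAtMost, Nat.add_div_right _ k.succ_pos, List.range_succ_eq_map]
  simp only [List.map_cons, List.map_map, List.sum_cons, zero_mul, Nat.sub_zero]
  congr 2
  refine List.map_congr_left fun j _ => ?_
  simp only [Function.comp_apply, Nat.succ_eq_add_one, add_one_mul j, Nat.add_sub_add_right]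

lemma pA_eq_partsAtMost (k n : ℕ) : pA (fun i => i + 1) k n = partsAtMost k n := by
  induction k generalizing n with
  | zero => simp [pA_zero_right, partsAtMost]
  | succ k ih =>
    induction n using Nat.strong_induction_on with
    | _ n ihn =>
      rw [pA_succ (fun i => i.succ_pos), ih]
      rcases lt_or_ge n (k + 1) with h | h
      · rw [pA_of_neg _ _ (by push_cast; omega), partsAtMost_of_lt h, add_zero]
      · obtain ⟨m, rfl⟩ := Nat.exists_eq_add_of_le' h
        rw [partsAtMost_add, ← ihn m (by omega)]
        congr 2
        push_cast
        ring

lemma partsAtMost_one (n : ℕ) : partsAtMost 1 n = 1 := by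
  induction n with
  | zero => decide
  | succ n ih => rw [partsAtMost_add 0 n, ih]; simp [partsAtMost]

lemma partsAtMost_two (n : ℕ) : partsAtMost 2 n = n / 2 + 1 := by
  induction n using Nat.twoStepInduction with
  | zero => decide
  | one => decide
  | more n ih _ => rw [partsAtMost_add 1 n, ih, partsAtMost_one]; omega

/-- Strong induction with step `d`. -/
lemma nat_induction_step {P : ℕ → Prop} {d : ℕ} (hd : 0 < d) (base : ∀ n < d, P n)
    (step : ∀ n, P n → P (n + d)) (n : ℕ) : P n := by
  induction n using Nat.strong_induction_on with
  | _ n ih =>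
    rcases lt_or_ge n d with h | h
    · exact base n h
    · obtain ⟨m, rfl⟩ := Nat.exists_eq_add_of_le' h
      exact step m (ih m (by omega))

lemma partsAtMost_three_add_six (n : ℕ) : partsAtMost 3 (n + 6) = partsAtMost 3 n + n + 6 := by
  have h₁ := partsAtMost_add 2 n
  have h₂ := partsAtMost_add 2 (n + 3)
  simp only [partsAtMost_two] at h₁ h₂
  norm_num [add_assoc] at h₁ h₂
  omega

lemma partsAtMost_three (n : ℕ) : partsAtMost 3 n = (n ^ 2 + 6 * n + 12) / 12 := by
  induction n using nat_induction_step (d := 6) with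
  | hd => norm_num
  | base n h => revert n; decide +kernel
  | step n ih =>
    rw [partsAtMost_three_add_six, ih]
    ring_nf
    omega

lemma partsAtMost_four_add_twelve (n : ℕ) : partsAtMost 4 (n + 12) =
    partsAtMost 4 n + partsAtMost 3 (n + 4) + partsAtMost 3 (n + 8) + partsAtMost 3 (n + 12) := by
  have h₁ := partsAtMost_add 3 n
  have h₂ := partsAtMost_add 3 (n + 4)
  have h₃ := partsAtMost_add 3 (n + 8)
  norm_num [add_assoc] at h₁ h₂ h₃
  omega

lemma partsAtMost_five_add_sixty (n : ℕ) : partsAtMost 5 (n + 60) =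
    partsAtMost 5 n + ∑ j ∈ Finset.range 12, partsAtMost 4 (n + 5 * (j + 1)) := by
  have h (m : ℕ) : partsAtMost 5 (n + 5 * m) =
      partsAtMost 5 n + ∑ j ∈ Finset.range m, partsAtMost 4 (n + 5 * (j + 1)) := by
    induction m with
    | zero => simp
    | succ m ih =>
      rw [Finset.sum_range_succ, ← add_assoc, ← ih, mul_add_one, ← add_assoc,
        partsAtMost_add 4, add_comm]
  exact h 12

lemma four_mul_partsAtMost_three (n : ℕ) : 4 * (partsAtMost 3 (n + 4) +
    partsAtMost 3 (n + 8) + partsAtMost 3 (n + 12)) + 3 * (n % 2) = n ^ 2 + 22 * n + 132 := by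
  induction n using nat_induction_step (d := 6) with
  | hd => norm_num
  | base n h => simp only [partsAtMost_three]; revert n; decide +kernel
  | step n ih =>
    have h (c : ℕ) : partsAtMost 3 (n + 6 + c) = partsAtMost 3 (n + c) + (n + c) + 6 := by
      rw [← partsAtMost_three_add_six]; congr 1; omega
    rw [h, h, h, show (n + 6) % 2 = n % 2 by omega]
    linarith

lemma partsAtMost_four_bounds (n : ℕ) :
    n ^ 3 + 15 * n ^ 2 + 72 * n + 49 ≤ 144 * partsAtMost 4 n + 9 * (n * (n % 2)) ∧
      144 * partsAtMost 4 n + 9 * (n * (n % 2)) ≤ n ^ 3 + 15 * n ^ 2 + 72 * n + 144 := by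
  induction n using nat_induction_step (d := 12) with
  | hd => norm_num
  | base n h =>
    rw [partsAtMost]
    simp only [partsAtMost_three]
    revert n
    decide +kernel
  | step n ih =>
    have h := four_mul_partsAtMost_three n
    rw [partsAtMost_four_add_twelve, show (n + 12) % 2 = n % 2 by omega]
    constructor <;> linarith [ih.1, ih.2]

lemma partsAtMost_four (n : ℕ) : partsAtMost 4 n =
    (n ^ 3 + 15 * n ^ 2 + 72 * n + 144 - 9 * (n * (n % 2))) / 144 := by
  have h := partsAtMost_four_bounds n
  omega

lemma sum_partsAtMost_three (n : ℕ) :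
    ∑ j ∈ Finset.range 12, (partsAtMost 3 (n + 5 * (j + 1) + 4) +
      partsAtMost 3 (n + 5 * (j + 1) + 8) + partsAtMost 3 (n + 5 * (j + 1) + 12)) =
      3 * n ^ 2 + 261 * n + 6599 := by
  induction n using nat_induction_step (d := 6) with
  | hd => norm_num
  | base n h =>
    simp only [partsAtMost_three]
    revert n
    decide +kernel
  | step n ih =>
    have h (m c : ℕ) : partsAtMost 3 (n + 6 + m + c) = partsAtMost 3 (n + m + c) + (n + m + c) + 6 := by
      rw [← partsAtMost_three_add_six]; congr 1; omega
    simp only [h]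
    simp only [Finset.sum_range_succ, Finset.sum_range_zero] at ih ⊢
    linarith

lemma sum_partsAtMost_four (n : ℕ) :
    24 * ∑ j ∈ Finset.range 12, partsAtMost 4 (n + 5 * (j + 1)) + 45 * (n % 2) =
      2 * n ^ 3 + 225 * n ^ 2 + 10210 * n + 171960 := by
  induction n using nat_induction_step (d := 12) with
  | hd => norm_num
  | base n h =>
    simp only [partsAtMost_four]
    revert n
    decide +kernel
  | step n ih =>
    have h (m : ℕ) : partsAtMost 4 (n + 12 + m) = partsAtMost 4 (n + m) +
        (partsAtMost 3 (n + m + 4) + partsAtMost 3 (n + m + 8) + partsAtMost 3 (n + m + 12)) := by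
      rw [add_right_comm, partsAtMost_four_add_twelve]; omega
    simp only [h, Finset.sum_add_distrib (f := fun j => partsAtMost 4 (n + 5 * (j + 1)))]
    rw [sum_partsAtMost_three, show (n + 12) % 2 = n % 2 by omega]
    linarith

lemma partsAtMost_five_bounds (n : ℕ) :
    n ^ 4 + 30 * n ^ 3 + 310 * n ^ 2 + 1320 * n + 949 ≤
        2880 * partsAtMost 5 n + 90 * (n * (n % 2)) ∧
      2880 * partsAtMost 5 n + 90 * (n * (n % 2)) ≤
        n ^ 4 + 30 * n ^ 3 + 310 * n ^ 2 + 1320 * n + 2880 := by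
  induction n using nat_induction_step (d := 60) with
  | hd => norm_num
  | base n h =>
    rw [partsAtMost]
    simp only [partsAtMost_four]
    revert n
    decide +kernel
  | step n ih =>
    have h := sum_partsAtMost_four n
    rw [partsAtMost_five_add_sixty, show (n + 60) % 2 = n % 2 by omega]
    constructor <;> linarith [ih.1, ih.2]

lemma partsAtMost_five (n : ℕ) : partsAtMost 5 n =
    (n ^ 4 + 30 * n ^ 3 + 310 * n ^ 2 + 1320 * n + 2880 - 90 * (n * (n % 2))) / 2880 := by
  have h := partsAtMost_five_bounds n
  omega

lemma partsAtMost_five_ratio {n : ℕ} (hn : 60 < n) :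
    ((n + 1) ^ 2 + 1) * (partsAtMost 5 (n + 2) * partsAtMost 5 n) <
      (n + 1) ^ 2 * partsAtMost 5 (n + 1) ^ 2 := by
  rcases lt_or_ge n 100 with h | h
  · have key : ∀ m < 100, 60 < m → ((m + 1) ^ 2 + 1) * (partsAtMost 5 (m + 2) * partsAtMost 5 m) <
        (m + 1) ^ 2 * partsAtMost 5 (m + 1) ^ 2 := by
      simp only [partsAtMost_five]
      decide +kernel
    exact key n h hn
  · have hmid := (partsAtMost_five_bounds (n + 1)).1
    have hlow := (partsAtMost_five_bounds n).2
    have hhigh := (partsAtMost_five_bounds (n + 2)).2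
    have hpar : (n + 1) * ((n + 1) % 2) ≤ n + 1 :=
      (Nat.mul_le_mul_left _ (by omega)).trans_eq (mul_one _)
    obtain ⟨m, rfl⟩ := Nat.exists_eq_add_of_le' h
    have hx : 2880 * partsAtMost 5 (m + 100) ≤ (m + 100) ^ 4 + 30 * (m + 100) ^ 3 +
        310 * (m + 100) ^ 2 + 1320 * (m + 100) + 2880 := by omega
    have hz : 2880 * partsAtMost 5 (m + 100 + 2) ≤ (m + 100 + 2) ^ 4 + 30 * (m + 100 + 2) ^ 3 +
        310 * (m + 100 + 2) ^ 2 + 1320 * (m + 100 + 2) + 2880 := by omega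
    have hy : (m + 100 + 1) ^ 4 + 30 * (m + 100 + 1) ^ 3 + 310 * (m + 100 + 1) ^ 2 +
        1230 * (m + 100 + 1) + 949 ≤ 2880 * partsAtMost 5 (m + 100 + 1) := by linarith
    have hxz := Nat.mul_le_mul_left ((m + 100 + 1) ^ 2 + 1) (Nat.mul_le_mul hz hx)
    have hyy := Nat.mul_le_mul_left ((m + 100 + 1) ^ 2) (Nat.pow_le_pow_left hy 2)
    have hpoly : ((m + 100 + 1) ^ 2 + 1) * (((m + 100 + 2) ^ 4 + 30 * (m + 100 + 2) ^ 3 +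
        310 * (m + 100 + 2) ^ 2 + 1320 * (m + 100 + 2) + 2880) * ((m + 100) ^ 4 +
        30 * (m + 100) ^ 3 + 310 * (m + 100) ^ 2 + 1320 * (m + 100) + 2880)) <
        (m + 100 + 1) ^ 2 * ((m + 100 + 1) ^ 4 + 30 * (m + 100 + 1) ^ 3 +
        310 * (m + 100 + 1) ^ 2 + 1230 * (m + 100 + 1) + 949) ^ 2 := by
      zify
      rw [← sub_pos]
      ring_nf
      positivity
    refine lt_of_mul_lt_mul_left (a := 2880 ^ 2) ?_ (by norm_num)
    linarith

theorem stmt10 :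
    (∀ n : ℕ, 61 < n →
      (1 + 1 / (n : ℝ) ^ 2) * (pA (fun i => i + 1) 5 ((n : ℤ) + 1) : ℝ) *
          (pA (fun i => i + 1) 5 ((n : ℤ) - 1) : ℝ) <
        (pA (fun i => i + 1) 5 (n : ℤ) : ℝ) ^ 2) ∧
    (∀ n : ℕ, 37 < n →
      pA (fun i => i + 1) 5 ((n : ℤ) + 1) * pA (fun i => i + 1) 5 ((n : ℤ) - 1) <
        pA (fun i => i + 1) 5 (n : ℤ) ^ 2) := by
  have hcast (n : ℕ) : pA (fun i => i + 1) 5 (((n + 1 : ℕ) : ℤ) + 1) = partsAtMost 5 (n + 2) ∧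
      pA (fun i => i + 1) 5 (((n + 1 : ℕ) : ℤ) - 1) = partsAtMost 5 n := by
    rw [← pA_eq_partsAtMost, ← pA_eq_partsAtMost]
    refine ⟨?_, ?_⟩
    all_goals
      congr 1
      try omega
  constructor
  · intro n hn
    obtain ⟨m, rfl⟩ := Nat.exists_eq_add_of_le' (show 1 ≤ n by omega)
    rw [(hcast m).1, (hcast m).2, pA_eq_partsAtMost]
    have h : (((m + 1 : ℕ) : ℝ) ^ 2 + 1) * (partsAtMost 5 (m + 2) * partsAtMost 5 m) <
        ((m + 1 : ℕ) : ℝ) ^ 2 * (partsAtMost 5 (m + 1) : ℝ) ^ 2 := by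
      exact_mod_cast partsAtMost_five_ratio (n := m) (by omega)
    have hpos : (0 : ℝ) < ((m + 1 : ℕ) : ℝ) ^ 2 := by positivity
    refine lt_of_mul_lt_mul_left (lt_of_eq_of_lt ?_ h) hpos.le
    field_simp
  · intro n hn
    obtain ⟨m, rfl⟩ := Nat.exists_eq_add_of_le' (show 1 ≤ n by omega)
    rw [(hcast m).1, (hcast m).2, pA_eq_partsAtMost]
    rcases lt_or_ge 60 m with h | h
    · have := partsAtMost_five_ratio h
      refine lt_of_mul_lt_mul_left (lt_of_le_of_lt ?_ this) (Nat.zero_le _)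
      exact Nat.mul_le_mul_right _ (Nat.le_succ _)
    · have key : ∀ m < 61, 36 < m →
          partsAtMost 5 (m + 2) * partsAtMost 5 m < partsAtMost 5 (m + 1) ^ 2 := by
        simp only [partsAtMost_five]
        decide +kernel
      exact key m (by omega) (by omega)
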